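/- arXiv:2312.00760 — 4 statements merged into one kernel-verified Lean document; each statement's English description precedes it below -/
import Mathlib

section
/- Let ω₀, r, ξ be real numbers with ω₀ > 0, r > 0 and 0 < ξ ≤ 1, and set β = 2ξ² − 1 and μ = 4ξ²(ξ − 1)(ξ + 1). If (ω, γ) is a real pair satisfying n(ω, γ) = 0 and (∂n/∂ω)(ω, γ) = 0, then (γ² − 1)(γ² − r⁴)·M(γ) = 0, where M(γ) = μγ⁴ + ((r² − 1)² − 2μr²)γ² + μr⁴. -/
/-- The bivariate polynomial
`n(ω, γ) = (γ² − r⁴)ω⁴ + 2r²ω₀²β(γ² − r²)ω² + r⁴ω₀⁴(γ² − 1)`. -/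
def nPoly (ω₀ r β : ℝ) (ω γ : ℝ) : ℝ :=
  (γ ^ 2 - r ^ 4) * ω ^ 4 + 2 * r ^ 2 * ω₀ ^ 2 * β * (γ ^ 2 - r ^ 2) * ω ^ 2 +
    r ^ 4 * ω₀ ^ 4 * (γ ^ 2 - 1)

theorem hasDerivAt_nPoly (ω₀ r β ω γ : ℝ) :
    HasDerivAt (fun w => nPoly ω₀ r β w γ)
      (2 * ω * (2 * (γ ^ 2 - r ^ 4) * ω ^ 2 + 2 * r ^ 2 * ω₀ ^ 2 * β * (γ ^ 2 - r ^ 2))) ω := by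
  have h := (((hasDerivAt_pow 4 ω).const_mul (γ ^ 2 - r ^ 4)).add
    ((hasDerivAt_pow 2 ω).const_mul (2 * r ^ 2 * ω₀ ^ 2 * β * (γ ^ 2 - r ^ 2)))).add_const
    (r ^ 4 * ω₀ ^ 4 * (γ ^ 2 - 1))
  refine h.congr_deriv ?_
  push_cast
  ring

/-- Any real common solution `(ω, γ)` of `n = 0` and `∂n/∂ω = 0` satisfies
`(γ² − 1)(γ² − r⁴)·M(γ) = 0` where `M(γ) = μγ⁴ + ((r²−1)² − 2μr²)γ² + μr⁴`. -/
theorem critical_points_satisfy_resultant (ω₀ r ξ β μ : ℝ)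
    (hω₀ : 0 < ω₀) (hr : 0 < r) (hξ₁ : 0 < ξ) (hξ₂ : ξ ≤ 1)
    (hβ : β = 2 * ξ ^ 2 - 1) (hμ : μ = 4 * ξ ^ 2 * (ξ - 1) * (ξ + 1))
    (ω γ : ℝ) (h₁ : nPoly ω₀ r β ω γ = 0)
    (h₂ : deriv (fun w => nPoly ω₀ r β w γ) ω = 0) :
    (γ ^ 2 - 1) * (γ ^ 2 - r ^ 4) *
      (μ * γ ^ 4 + ((r ^ 2 - 1) ^ 2 - 2 * μ * r ^ 2) * γ ^ 2 + μ * r ^ 4) = 0 := by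
  rw [(hasDerivAt_nPoly ω₀ r β ω γ).deriv] at h₂
  unfold nPoly at h₁
  have hne : r ^ 4 * ω₀ ^ 4 ≠ 0 := by positivity
  rcases mul_eq_zero.mp h₂ with h | h
  · obtain rfl : ω = 0 := by linarith
    have hγ : γ ^ 2 - 1 = 0 :=
      (mul_eq_zero.mp (by linear_combination h₁)).resolve_left hne
    rw [hγ, zero_mul, zero_mul]
  · -- The discriminant of `n` in `ω ^ 2` is `4 * r ^ 4 * ω₀ ^ 4 * M(γ)`.
    have hM : μ * γ ^ 4 + ((r ^ 2 - 1) ^ 2 - 2 * μ * r ^ 2) * γ ^ 2 + μ * r ^ 4 = 0 := by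
      refine (mul_eq_zero.mp ?_).resolve_left hne
      subst hβ hμ
      linear_combination
        (2 * (γ ^ 2 - r ^ 4) * ω ^ 2 +
          2 * r ^ 2 * ω₀ ^ 2 * (2 * ξ ^ 2 - 1) * (γ ^ 2 - r ^ 2)) / 4 * h -
        (γ ^ 2 - r ^ 4) * h₁
    rw [hM, mul_zero]
end

section
/- Let ω₀, r, ξ be real numbers with ω₀ > 0, r > 0, r ≠ 1 and 0 < ξ < 1/√2, and set β = 2ξ² − 1. Then the polynomial F₁(ω) = βω⁴ + ω₀²(r² + 1)ω² + r²ω₀⁴β has exactly four distinct real roots; that is, the set {ω ∈ ℝ : F₁(ω) = 0} has exactly four elements. -/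
theorem encard_setOf_sq_eq_or_sq_eq {p q : ℝ} (hp : 0 < p) (hpq : p < q) :
    {x : ℝ | x ^ 2 = p ∨ x ^ 2 = q}.encard = 4 := by
  have hp' : 0 < √p := Real.sqrt_pos.2 hp
  have hlt : √p < √q := Real.sqrt_lt_sqrt hp.le hpq
  have hset : {x : ℝ | x ^ 2 = p ∨ x ^ 2 = q} = {-√q, -√p, √p, √q} := by
    ext x
    have h₁ : x ^ 2 = p ↔ x = √p ∨ x = -√p := by
      rw [← sq_eq_sq_iff_eq_or_eq_neg, Real.sq_sqrt hp.le]
    have h₂ : x ^ 2 = q ↔ x = √q ∨ x = -√q := by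
      rw [← sq_eq_sq_iff_eq_or_eq_neg, Real.sq_sqrt (hp.trans hpq).le]
    simp only [Set.mem_ofPred_eq, Set.mem_insert_iff, Set.mem_singleton_iff, h₁, h₂]
    tauto
  rw [hset, Set.encard_insert_of_notMem, Set.encard_insert_of_notMem, Set.encard_pair hlt.ne]
  · norm_num
  · simp only [Set.mem_insert_iff, Set.mem_singleton_iff, not_or]
    constructor <;> linarith
  · simp only [Set.mem_insert_iff, Set.mem_singleton_iff, not_or]
    refine ⟨?_, ?_, ?_⟩ <;> linarith

theorem encard_setOf_biquadratic_eq_zero {a b c : ℝ} (ha : a < 0) (hb : 0 < b) (hc : c < 0)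
    (hd : 0 < discrim a b c) :
    {x : ℝ | a * x ^ 4 + b * x ^ 2 + c = 0}.encard = 4 := by
  have hs : 0 < √(discrim a b c) := Real.sqrt_pos.2 hd
  have hss : discrim a b c = √(discrim a b c) * √(discrim a b c) :=
    (Real.mul_self_sqrt hd.le).symm
  have hsb : √(discrim a b c) < b := by
    rw [Real.sqrt_lt' hb, discrim]
    linarith [mul_pos_of_neg_of_neg ha hc]
  rw [← encard_setOf_sq_eq_or_sq_eq (p := (-b + √(discrim a b c)) / (2 * a))
    (q := (-b - √(discrim a b c)) / (2 * a))
    (div_pos_of_neg_of_neg (by linarith) (by linarith))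
    (div_lt_div_of_neg_of_lt (by linarith) (by linarith))]
  congr 1
  ext x
  rw [Set.mem_ofPred_eq, Set.mem_ofPred_eq, ← quadratic_eq_zero_iff ha.ne hss]
  ring_nf


/-- For `ω₀ > 0`, `r > 0`, `r ≠ 1`, `0 < ξ < 1/√2` and `β = 2ξ² − 1`, the polynomial
`F₁(ω) = βω⁴ + ω₀²(r²+1)ω² + r²ω₀⁴β` has exactly four distinct real roots. -/
theorem F1_four_real_roots (ω₀ r ξ β : ℝ) (hω₀ : 0 < ω₀) (hr : 0 < r) (hr1 : r ≠ 1)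
    (hξ₁ : 0 < ξ) (hξ₂ : ξ < 1 / Real.sqrt 2) (hβ : β = 2 * ξ ^ 2 - 1) :
    Set.encard {ω : ℝ |
      β * ω ^ 4 + ω₀ ^ 2 * (r ^ 2 + 1) * ω ^ 2 + r ^ 2 * ω₀ ^ 4 * β = 0} = 4 := by
  have hξ : ξ ^ 2 < 1 / 2 := by
    calc ξ ^ 2 < (1 / √2) ^ 2 := by gcongr
      _ = 1 / 2 := by rw [div_pow, Real.sq_sqrt zero_le_two, one_pow]
  have hβ₀ : β < 0 := by linarith
  have hβ₁ : β ^ 2 < 1 := by nlinarith [pow_pos hξ₁ 2]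
  refine encard_setOf_biquadratic_eq_zero hβ₀ (by positivity)
    (mul_neg_of_pos_of_neg (by positivity) hβ₀) ?_
  have h : discrim β (ω₀ ^ 2 * (r ^ 2 + 1)) (r ^ 2 * ω₀ ^ 4 * β) =
      ω₀ ^ 4 * ((r ^ 2 - 1) ^ 2 + 4 * r ^ 2 * (1 - β ^ 2)) := by
    rw [discrim]
    ring
  have : 0 < 1 - β ^ 2 := sub_pos.2 hβ₁
  rw [h]
  positivity
end

section
/- Let r, ξ be real numbers with r > 0, r ≠ 1 and 0 < ξ < 1, and set μ = 4ξ²(ξ − 1)(ξ + 1). Then the polynomial M(γ) = μγ⁴ + ((r² − 1)² − 2μr²)γ² + μr⁴ has exactly four distinct real roots; that is, the set {γ ∈ ℝ : M(γ) = 0} has exactly four elements. -/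
/-- The roots of `(γ² - a²)(γ² - b²)`, for `a > 0 > b` and `a + b ≠ 0`, are four distinct reals. -/
theorem encard_pm_pair {a b : ℝ} (ha : 0 < a) (hb : b < 0) (hab : a + b ≠ 0) :
    Set.encard ({a, b, -a, -b} : Set ℝ) = 4 := by
  have h₁ : a ∉ ({b, -a, -b} : Set ℝ) := by
    rintro (h | h | h)
    · linarith
    · linarith
    · exact hab (by rw [h]; ring)
  have h₂ : b ∉ ({-a, -b} : Set ℝ) := by
    rintro (h | h)
    · exact hab (by rw [h]; ring)
    · have : b = -b := h
      linarith
  have h₃ : -a ≠ -b := fun h => by linarith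
  rw [Set.encard_insert_of_notMem h₁, Set.encard_insert_of_notMem h₂, Set.encard_pair h₃]
  norm_num

/-- Every real `d` and `r > 0` admit `a > 0 > b` with sum `d` and product `-r²`. -/
theorem exists_pos_neg_add_eq_mul_eq_neg_sq (d : ℝ) {r : ℝ} (hr : 0 < r) :
    ∃ a b : ℝ, 0 < a ∧ b < 0 ∧ a + b = d ∧ a * b = -r ^ 2 := by
  have he : √(d ^ 2 + 4 * r ^ 2) ^ 2 = d ^ 2 + 4 * r ^ 2 := Real.sq_sqrt (by positivity)
  have habs : |d| < √(d ^ 2 + 4 * r ^ 2) :=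
    Real.lt_sqrt_of_sq_lt (by rw [sq_abs]; nlinarith [pow_pos hr 2])
  obtain ⟨h₁, h₂⟩ := abs_lt.mp habs
  exact ⟨(d + √(d ^ 2 + 4 * r ^ 2)) / 2, (d - √(d ^ 2 + 4 * r ^ 2)) / 2,
    by linarith, by linarith, by ring, by linear_combination -he / 4⟩

/-- For `r > 0`, `r ≠ 1`, `0 < ξ < 1` and `μ = 4ξ²(ξ−1)(ξ+1)`, the polynomial
`M(γ) = μγ⁴ + ((r²−1)² − 2μr²)γ² + μr⁴` has exactly four distinct real roots. -/
theorem M_four_real_roots (r ξ μ : ℝ) (hr : 0 < r) (hr1 : r ≠ 1)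
    (hξ₁ : 0 < ξ) (hξ₂ : ξ < 1) (hμ : μ = 4 * ξ ^ 2 * (ξ - 1) * (ξ + 1)) :
    Set.encard {γ : ℝ |
      μ * γ ^ 4 + ((r ^ 2 - 1) ^ 2 - 2 * μ * r ^ 2) * γ ^ 2 + μ * r ^ 4 = 0} = 4 := by
  have hμneg : 0 < -μ := by
    have : 0 < 4 * ξ ^ 2 * (1 - ξ) * (1 + ξ) := by
      have := sub_pos.mpr hξ₂
      positivity
    rw [hμ]
    linarith
  have hs : 0 < √(-μ) := Real.sqrt_pos.mpr hμneg
  have hs2 : √(-μ) ^ 2 = -μ := Real.sq_sqrt hμneg.le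
  have hr2 : r ^ 2 - 1 ≠ 0 := by
    rw [show r ^ 2 - 1 = (r - 1) * (r + 1) by ring]
    exact mul_ne_zero (sub_ne_zero.mpr hr1) (by positivity)
  obtain ⟨a, b, ha, hb, hsum, hprod⟩ :=
    exists_pos_neg_add_eq_mul_eq_neg_sq ((r ^ 2 - 1) / √(-μ)) hr
  have hab : a + b ≠ 0 := hsum ▸ div_ne_zero hr2 hs.ne'
  have hsq : -μ * (a + b) ^ 2 = (r ^ 2 - 1) ^ 2 := by
    rw [hsum, div_pow, hs2, mul_div_cancel₀ _ hμneg.ne']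
  have hfactor (γ : ℝ) :
      μ * γ ^ 4 + ((r ^ 2 - 1) ^ 2 - 2 * μ * r ^ 2) * γ ^ 2 + μ * r ^ 4 =
        μ * ((γ - a) * ((γ - b) * ((γ + a) * (γ + b)))) := by
    rw [← hsq]
    linear_combination (-μ) * (2 * γ ^ 2 + a * b - r ^ 2) * hprod
  rw [← encard_pm_pair ha hb hab]
  congr 1
  ext γ
  simp [hfactor, (neg_pos.mp hμneg).ne, sub_eq_zero, add_eq_zero_iff_eq_neg]
end

section
/- Let r, ξ be real numbers with r > 0, r ≠ 1 and 0 < ξ < 1/√2, and set μ = 4ξ²(ξ − 1)(ξ + 1). Let δ be the greatest real root of M(γ) = μγ⁴ + ((r² − 1)² − 2μr²)γ² + μr⁴ (i.e. M(δ) = 0 and every real x with M(x) = 0 satisfies x ≤ δ). Then δ > 1 and δ > r². -/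
/-- With `ν = -μ`, `M(x) = D x² - ν (x² - r²)²` where `D = (r² - 1)²`. If this is positive at
some `a > 0`, it has a root beyond `a`. -/
theorem exists_root_gt_of_pos {ν D r a : ℝ} (hν : 0 < ν) (hD : 0 ≤ D) (hr : 0 < r) (ha : 0 < a)
    (hpos : 0 < D * a ^ 2 - ν * (a ^ 2 - r ^ 2) ^ 2) :
    ∃ x, a < x ∧ D * x ^ 2 - ν * (x ^ 2 - r ^ 2) ^ 2 = 0 := by
  obtain ⟨K, hK, hDK⟩ : ∃ K : ℝ, 0 < K ∧ D ≤ ν * K ^ 2 := by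
    have hq : 0 ≤ D / ν := by positivity
    refine ⟨D / ν + 1, by positivity, ?_⟩
    calc D = ν * (D / ν) := by field_simp
      _ ≤ ν * (D / ν + 1) ^ 2 := by gcongr; nlinarith
  set B := a + r + K with hB
  have hB0 : 0 < B := by positivity
  have hneg : D * B ^ 2 - ν * (B ^ 2 - r ^ 2) ^ 2 ≤ 0 := by
    have h1 : K * B ≤ B ^ 2 - r ^ 2 := by
      have : K * B ≤ (B - r) * (B + r) := by
        gcongr <;> linarith
      linarith
    have h2 : (K * B) ^ 2 ≤ (B ^ 2 - r ^ 2) ^ 2 := by gcongr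
    have h3 := mul_le_mul_of_nonneg_left h2 hν.le
    have h4 := mul_le_mul_of_nonneg_right hDK (sq_nonneg B)
    linarith
  obtain ⟨x, hx, hx0⟩ := intermediate_value_Icc' (by linarith : a ≤ B)
    (f := fun x : ℝ => D * x ^ 2 - ν * (x ^ 2 - r ^ 2) ^ 2)
    (by fun_prop) ⟨hneg, hpos.le⟩
  refine ⟨x, lt_of_le_of_ne hx.1 ?_, hx0⟩
  rintro rfl
  exact hpos.ne' hx0


/-- For `r > 0`, `r ≠ 1`, `0 < ξ < 1/√2` and `μ = 4ξ²(ξ−1)(ξ+1)`, the greatest real root `δ`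
of `M(γ) = μγ⁴ + ((r²−1)² − 2μr²)γ² + μr⁴` satisfies `δ > 1` and `δ > r²`. -/
theorem M_greatest_root_gt (r ξ μ δ : ℝ) (hr : 0 < r) (hr1 : r ≠ 1)
    (hξ₁ : 0 < ξ) (hξ₂ : ξ < 1 / Real.sqrt 2) (hμ : μ = 4 * ξ ^ 2 * (ξ - 1) * (ξ + 1))
    (hδroot : μ * δ ^ 4 + ((r ^ 2 - 1) ^ 2 - 2 * μ * r ^ 2) * δ ^ 2 + μ * r ^ 4 = 0)
    (hδmax : ∀ x : ℝ,
      μ * x ^ 4 + ((r ^ 2 - 1) ^ 2 - 2 * μ * r ^ 2) * x ^ 2 + μ * r ^ 4 = 0 → x ≤ δ) :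
    1 < δ ∧ r ^ 2 < δ := by
  have hs : ξ ^ 2 < 1 / 2 := by
    have h : ξ ^ 2 < (1 / Real.sqrt 2) ^ 2 := by gcongr
    rwa [div_pow, Real.sq_sqrt (by norm_num), one_pow] at h
  have hs0 : 0 < ξ ^ 2 := by positivity
  have hμ0 : μ < 0 := by rw [hμ]; nlinarith
  have hμ1 : 0 < 1 + μ := by
    have h : 0 < (1 - 2 * ξ ^ 2) ^ 2 := pow_pos (by linarith) 2
    rw [hμ]
    linarith
  have hD : 0 < (r ^ 2 - 1) ^ 2 := by
    have h : r ^ 2 - 1 ≠ 0 := by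
      rwa [sub_ne_zero, Ne, pow_eq_one_iff_of_nonneg hr.le two_ne_zero]
    positivity
  have key : ∀ a : ℝ, 0 < a →
      0 < (r ^ 2 - 1) ^ 2 * a ^ 2 - -μ * (a ^ 2 - r ^ 2) ^ 2 → a < δ := by
    intro a ha hpos
    obtain ⟨x, hax, hx⟩ := exists_root_gt_of_pos (neg_pos.2 hμ0) hD.le hr ha hpos
    exact hax.trans_le (hδmax x (by linarith))
  constructor
  · refine key 1 one_pos ?_
    have := mul_pos hμ1 hD
    linarith
  · refine key (r ^ 2) (by positivity) ?_
    have := mul_pos (mul_pos hμ1 hD) (pow_pos hr 4)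
    linarith
end
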